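/- Let (u, ρ) be a smooth periodic solution on [0,T) of the periodic two-component Hunter–Saxton system with parameter k = 1. Then the pointwise identity ∂_t( u_xx² + ρ_x² ) + 4 u_x ( u_xx² + ρ_x² ) + u · ∂_x( u_xx² + ρ_x² ) = 0 holds at every (t,x) ∈ [0,T) × ℝ. -/

import Mathlib

open Real Set MeasureTheory intervalIntegral

/-- Partial derivative in the space variable (second argument). -/
noncomputable def pdx (f : ℝ → ℝ → ℝ) : ℝ → ℝ → ℝ := fun t x => deriv (f t) x

/-- Partial derivative in the time variable (first argument). -/
noncomputable def pdt (f : ℝ → ℝ → ℝ) : ℝ → ℝ → ℝ := fun t x => deriv (fun s => f s x) t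

theorem pdx_eq_fderiv {f : ℝ → ℝ → ℝ} (hf : ContDiff ℝ (⊤ : ℕ∞) (Function.uncurry f))
    (t x : ℝ) : pdx f t x = fderiv ℝ (Function.uncurry f) (t, x) (0, 1) := by
  have h := (hf.differentiable (by simp) (t, x)).hasFDerivAt
  exact (h.comp_hasDerivAt x ((hasDerivAt_const x t).prodMk (hasDerivAt_id x))).deriv

theorem pdt_eq_fderiv {f : ℝ → ℝ → ℝ} (hf : ContDiff ℝ (⊤ : ℕ∞) (Function.uncurry f))
    (t x : ℝ) : pdt f t x = fderiv ℝ (Function.uncurry f) (t, x) (1, 0) := by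
  have h := (hf.differentiable (by simp) (t, x)).hasFDerivAt
  exact (h.comp_hasDerivAt t ((hasDerivAt_id t).prodMk (hasDerivAt_const t x))).deriv

theorem contDiff_fderiv_apply_const {E : Type*} [NormedAddCommGroup E] [NormedSpace ℝ E]
    {F : E → ℝ} (hF : ContDiff ℝ (⊤ : ℕ∞) F) (v : E) :
    ContDiff ℝ (⊤ : ℕ∞) (fun p => fderiv ℝ F p v) :=
  (hF.fderiv_right (by simp)).clm_apply contDiff_const

theorem contDiff_uncurry_pdx {f : ℝ → ℝ → ℝ} (hf : ContDiff ℝ (⊤ : ℕ∞) (Function.uncurry f)) :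
    ContDiff ℝ (⊤ : ℕ∞) (Function.uncurry (pdx f)) := by
  convert contDiff_fderiv_apply_const hf (0, 1) using 1
  ext ⟨t, x⟩
  exact pdx_eq_fderiv hf t x

theorem contDiff_uncurry_pdt {f : ℝ → ℝ → ℝ} (hf : ContDiff ℝ (⊤ : ℕ∞) (Function.uncurry f)) :
    ContDiff ℝ (⊤ : ℕ∞) (Function.uncurry (pdt f)) := by
  convert contDiff_fderiv_apply_const hf (1, 0) using 1
  ext ⟨t, x⟩
  exact pdt_eq_fderiv hf t x

theorem hasDerivAt_pdx {f : ℝ → ℝ → ℝ} (hf : ContDiff ℝ (⊤ : ℕ∞) (Function.uncurry f))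
    (t x : ℝ) : HasDerivAt (fun y => f t y) (pdx f t x) x :=
  ((hf.differentiable (by simp)).comp (g := Function.uncurry f)
    (differentiable_const t |>.prodMk differentiable_id) x).hasDerivAt

theorem hasDerivAt_pdt {f : ℝ → ℝ → ℝ} (hf : ContDiff ℝ (⊤ : ℕ∞) (Function.uncurry f))
    (t x : ℝ) : HasDerivAt (fun s => f s x) (pdt f t x) t :=
  ((hf.differentiable (by simp)).comp (g := Function.uncurry f)
    (differentiable_id |>.prodMk (differentiable_const x)) t).hasDerivAt

/-- Mixed partial derivatives of a smooth function commute. -/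
theorem pdt_pdx_comm {f : ℝ → ℝ → ℝ} (hf : ContDiff ℝ (⊤ : ℕ∞) (Function.uncurry f))
    (t x : ℝ) : pdt (pdx f) t x = pdx (pdt f) t x := by
  have hd : DifferentiableAt ℝ (fderiv ℝ (Function.uncurry f)) (t, x) :=
    (hf.fderiv_right (m := (⊤ : ℕ∞)) (by simp)).differentiable (by simp) _
  have key (v w : ℝ × ℝ) : fderiv ℝ (fun p => fderiv ℝ (Function.uncurry f) p v) (t, x) w
      = fderiv ℝ (fderiv ℝ (Function.uncurry f)) (t, x) w v := by
    rw [fderiv_clm_apply hd (differentiableAt_const v)]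
    simp
  have hx : Function.uncurry (pdx f) = fun p => fderiv ℝ (Function.uncurry f) p (0, 1) := by
    ext ⟨s, y⟩
    exact pdx_eq_fderiv hf s y
  have ht : Function.uncurry (pdt f) = fun p => fderiv ℝ (Function.uncurry f) p (1, 0) := by
    ext ⟨s, y⟩
    exact pdt_eq_fderiv hf s y
  rw [pdt_eq_fderiv (contDiff_uncurry_pdx hf), pdx_eq_fderiv (contDiff_uncurry_pdt hf), hx, ht,
    key, key]
  exact ((hf.of_le (WithTop.coe_le_coe.2 (le_top : (2 : ℕ∞) ≤ ⊤))).contDiffAt.isSymmSndFDerivAt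
    (by simp)) _ _

theorem hunter_saxton_pointwise_identity (T : EReal) (hT : 0 < T)
    (u ρ : ℝ → ℝ → ℝ)
    (hu : ContDiff ℝ (⊤ : ℕ∞) (Function.uncurry u)) (hρ : ContDiff ℝ (⊤ : ℕ∞) (Function.uncurry ρ))
    (huper : ∀ t x : ℝ, u t (x + 1) = u t x) (hρper : ∀ t x : ℝ, ρ t (x + 1) = ρ t x)
    (heq1 : ∀ t x : ℝ, 0 ≤ t → (t : EReal) < T →
      pdt (pdx (pdx u)) t x + 2 * pdx u t x * pdx (pdx u) t x
        + u t x * pdx (pdx (pdx u)) t x - 1 * ρ t x * pdx ρ t x = 0)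
    (heq2 : ∀ t x : ℝ, 0 ≤ t → (t : EReal) < T →
      pdt ρ t x + pdx (fun s y => ρ s y * u s y) t x = 0) :
    ∀ t x : ℝ, 0 ≤ t → (t : EReal) < T →
      pdt (fun s y => (pdx (pdx u) s y) ^ 2 + (pdx ρ s y) ^ 2) t x
        + 4 * pdx u t x * ((pdx (pdx u) t x) ^ 2 + (pdx ρ t x) ^ 2)
        + u t x * pdx (fun s y => (pdx (pdx u) s y) ^ 2 + (pdx ρ s y) ^ 2) t x = 0 := by
  intro t x ht0 htT
  have hux := contDiff_uncurry_pdx hu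
  have huxx := contDiff_uncurry_pdx hux
  have hρx := contDiff_uncurry_pdx hρ
  have hmass (y : ℝ) : pdt ρ t y = -(pdx ρ t y * u t y + ρ t y * pdx u t y) := by
    have h := heq2 t y ht0 htT
    have hprod : pdx (fun s y => ρ s y * u s y) t y = pdx ρ t y * u t y + ρ t y * pdx u t y :=
      ((hasDerivAt_pdx hρ t y).mul (hasDerivAt_pdx hu t y)).deriv
    linarith
  have hρxt : pdt (pdx ρ) t x = -(pdx (pdx ρ) t x * u t x + pdx ρ t x * pdx u t x
      + (pdx ρ t x * pdx u t x + ρ t x * pdx (pdx u) t x)) := by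
    rw [pdt_pdx_comm hρ]
    have hfun : pdt ρ t = fun y => -(pdx ρ t y * u t y + ρ t y * pdx u t y) := funext hmass
    have hderiv := (((hasDerivAt_pdx hρx t x).mul (hasDerivAt_pdx hu t x)).add
      ((hasDerivAt_pdx hρ t x).mul (hasDerivAt_pdx hux t x))).neg
    change deriv (pdt ρ t) x = _
    rw [hfun]
    exact hderiv.deriv
  have hEt : pdt (fun s y => (pdx (pdx u) s y) ^ 2 + (pdx ρ s y) ^ 2) t x
      = 2 * pdx (pdx u) t x * pdt (pdx (pdx u)) t x + 2 * pdx ρ t x * pdt (pdx ρ) t x := by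
    have h := (((hasDerivAt_pdt huxx t x).pow 2).add ((hasDerivAt_pdt hρx t x).pow 2)).deriv
    simp only [Nat.cast_ofNat, Nat.add_one_sub_one, pow_one] at h
    exact h
  have hEx : pdx (fun s y => (pdx (pdx u) s y) ^ 2 + (pdx ρ s y) ^ 2) t x
      = 2 * pdx (pdx u) t x * pdx (pdx (pdx u)) t x + 2 * pdx ρ t x * pdx (pdx ρ) t x := by
    have h := (((hasDerivAt_pdx huxx t x).pow 2).add ((hasDerivAt_pdx hρx t x).pow 2)).deriv
    simp only [Nat.cast_ofNat, Nat.add_one_sub_one, pow_one] at h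
    exact h
  rw [hEt, hEx, hρxt]
  linear_combination 2 * pdx (pdx u) t x * heq1 t x ht0 htT
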